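/- Let H be a real Hilbert space and L : H → [0,∞) be twice continuously Fréchet differentiable. Let c : [0,∞) → [0,∞) be nonincreasing and such that for every r ≥ 0 and every x ∈ H with ‖x‖ ≤ r one has ‖∇L(x)‖ ≥ c(r)·√(L(x)), and set C(z) := ∫₀^z c(v) dv. Let x : [0,∞) → H be a gradient-flow trajectory of L and suppose there exists R > 0 with C(R) > C(‖x(0)‖) + 2√(L(x(0))). Then there exists x_∞ ∈ H with ‖x_∞‖ ≤ R and L(x_∞) = 0 such that x(t) → x_∞ in H as t → ∞. -/

import Mathlib

open Set Filter Topology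

theorem gradient_eq_zero_of_forall_ge {H : Type*} [NormedAddCommGroup H] [InnerProductSpace ℝ H]
    [CompleteSpace H] {L : H → ℝ} {z : H} (hz : ∀ w, L z ≤ L w) : gradient L z = 0 := by
  have h : IsLocalMin L z := Eventually.of_forall hz
  simp [gradient, h.fderiv_eq_zero]

theorem continuous_gradient_of_contDiff {H : Type*} [NormedAddCommGroup H] [InnerProductSpace ℝ H]
    [CompleteSpace H] {L : H → ℝ} (hL : ContDiff ℝ 2 L) : Continuous (gradient L) :=
  (InnerProductSpace.toDual ℝ H).symm.continuous.comp (hL.continuous_fderiv (by norm_num))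

theorem hasDerivWithinAt_comp_gradientFlow {H : Type*} [NormedAddCommGroup H]
    [InnerProductSpace ℝ H] [CompleteSpace H] {L : H → ℝ} {x : ℝ → H} {s : Set ℝ} {t : ℝ}
    (hL : DifferentiableAt ℝ L (x t)) (hx : HasDerivWithinAt x (-gradient L (x t)) s t) :
    HasDerivWithinAt (fun τ => L (x τ)) (-‖gradient L (x t)‖ ^ 2) s t := by
  have h := hL.hasGradientAt.hasFDerivAt.comp_hasDerivWithinAt t hx
  rwa [map_neg, InnerProductSpace.toDual_apply_apply, real_inner_self_eq_norm_sq] at h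

theorem integral_le_mul_sub_of_antitone {c : ℝ → ℝ} (hc : Antitone c) {a b : ℝ} (hab : a ≤ b) :
    ∫ v in a..b, c v ≤ c a * (b - a) := by
  have h := intervalIntegral.integral_mono_on (μ := MeasureTheory.volume) hab
    hc.intervalIntegrable (g := fun _ => c a) (by simp) (fun v hv => hc hv.1)
  simpa [mul_comm] using h

/-- A comparison principle: along an increasing curve `ρ`, the primitive of the antitone function
`c` plus `E` does not increase as soon as the derivative `e` of `E` is at most `-(c ∘ ρ) * n`, where
`n` is the derivative of `ρ`. -/
theorem integral_add_le_of_hasDerivWithinAt {c ρ E n e : ℝ → ℝ} (hc : Antitone c)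
    (hρ : ∀ t, HasDerivAt ρ (n t) t) (hρm : Monotone ρ) (hEc : ContinuousOn E (Ici 0))
    (hE : ∀ t, 0 ≤ t → HasDerivWithinAt E (e t) (Ici t) t)
    (hle : ∀ t, 0 ≤ t → e t ≤ -(c (ρ t) * n t)) {T : ℝ} (hT : 0 ≤ T) :
    (∫ v in (0 : ℝ)..ρ T, c v) + E T ≤ (∫ v in (0 : ℝ)..ρ 0, c v) + E 0 := by
  have hint : ∀ a b, IntervalIntegrable c MeasureTheory.volume a b :=
    fun a b => hc.intervalIntegrable
  have hρc : Continuous ρ := continuous_iff_continuousAt.2 fun t => (hρ t).continuousAt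
  refine image_le_of_liminf_slope_right_le_deriv_boundary (a := 0) (b := T)
    (f := fun t => (∫ v in (0 : ℝ)..ρ t, c v) + E t)
    (B := fun _ => (∫ v in (0 : ℝ)..ρ 0, c v) + E 0) (B' := fun _ => 0)
    ?_ le_rfl continuousOn_const (fun t _ => hasDerivWithinAt_const _ _ _) ?_
    (right_mem_Icc.2 hT)
  · exact ((intervalIntegral.continuous_primitive hint 0).comp hρc).continuousOn.add
      (hEc.mono Icc_subset_Ici_self)
  · intro t ht r hr
    have hd : HasDerivWithinAt (fun τ => c (ρ t) * ρ τ + E τ) (c (ρ t) * n t + e t) (Ioi t) t :=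
      (((hρ t).const_mul (c (ρ t))).hasDerivWithinAt).add
        ((hE t ht.1).mono Ioi_subset_Ici_self)
    have hlt : c (ρ t) * n t + e t < r := by linarith [hle t ht.1]
    have hev := (hasDerivWithinAt_iff_tendsto_slope' (by simp)).1 hd |>.eventually_lt_const hlt
    refine Eventually.frequently ?_
    filter_upwards [hev, self_mem_nhdsWithin] with z hz htz
    refine lt_of_le_of_lt ?_ hz
    have htz' : t < z := htz
    have h1 := integral_le_mul_sub_of_antitone hc (hρm htz'.le)
    have h2 := intervalIntegral.integral_add_adjacent_intervals (hint 0 (ρ t)) (hint (ρ t) (ρ z))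
    rw [slope_def_field, slope_def_field]
    refine div_le_div_of_nonneg_right ?_ (by linarith)
    linarith

/-- Convergence of gradient flows under a Łojasiewicz-type condition whose constant `c` is
antitone on the whole real line. -/
theorem exists_tendsto_gradientFlow_of_antitone {H : Type*} [NormedAddCommGroup H]
    [InnerProductSpace ℝ H] [CompleteSpace H]
    (L : H → ℝ) (hL_nonneg : ∀ z, 0 ≤ L z) (hL : ContDiff ℝ 2 L)
    (c : ℝ → ℝ) (hc_nonneg : ∀ r, 0 ≤ c r) (hc : Antitone c)
    (hLoj : ∀ z : H, c ‖z‖ * √(L z) ≤ ‖gradient L z‖)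
    (x : ℝ → H)
    (hx : ∀ t ∈ Ici (0 : ℝ), HasDerivWithinAt x (-gradient L (x t)) (Ici 0) t)
    (R : ℝ) (hR : 0 < R)
    (hRC : (∫ v in (0 : ℝ)..‖x 0‖, c v) + 2 * √(L (x 0)) < ∫ v in (0 : ℝ)..R, c v) :
    ∃ xinf : H, ‖xinf‖ ≤ R ∧ L xinf = 0 ∧ Tendsto x atTop (𝓝 xinf) := by
  have hint : ∀ a b, IntervalIntegrable c MeasureTheory.volume a b :=
    fun a b => hc.intervalIntegrable
  have hxc : ContinuousOn x (Ici 0) := fun t ht => (hx t ht).continuousWithinAt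
  have hx' : ∀ t, 0 ≤ t → HasDerivWithinAt x (-gradient L (x t)) (Ici t) t :=
    fun t ht => (hx t ht).mono (Ici_subset_Ici.2 ht)
  have hLx : ∀ t ∈ Ici (0 : ℝ),
      HasDerivWithinAt (fun τ => L (x τ)) (-‖gradient L (x t)‖ ^ 2) (Ici 0) t :=
    fun t ht => hasDerivWithinAt_comp_gradientFlow
      (hL.differentiable (by norm_num)).differentiableAt (hx t ht)
  have hLxc : ContinuousOn (fun τ => L (x τ)) (Ici 0) := fun t ht => (hLx t ht).continuousWithinAt
  have hLanti : AntitoneOn (fun τ => L (x τ)) (Ici 0) :=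
    antitoneOn_of_hasDerivWithinAt_nonpos (convex_Ici 0) hLxc
      (fun t ht => (hLx t (interior_subset ht)).mono interior_subset)
      (fun t _ => by simp)
  -- `ρ t` is `‖x 0‖` plus the length of the trajectory on `[0, t]`
  set n : ℝ → ℝ := fun t => ‖gradient L (x (max t 0))‖ with hn
  have hnx : ∀ t, 0 ≤ t → n t = ‖gradient L (x t)‖ := fun t ht => by simp [hn, ht]
  have hnc : Continuous n := ((continuous_gradient_of_contDiff hL).comp
    (hxc.comp_continuous (by fun_prop) (fun t => mem_Ici.2 (le_max_right _ _)))).norm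
  set ρ : ℝ → ℝ := fun t => ‖x 0‖ + ∫ τ in (0 : ℝ)..t, n τ with hρdef
  have hρ0 : ρ 0 = ‖x 0‖ := by simp [hρdef]
  have hρ : ∀ t, HasDerivAt ρ (n t) t := fun t =>
    (hnc.integral_hasStrictDerivAt 0 t).hasDerivAt.const_add _
  have hρm : Monotone ρ := monotone_of_hasDerivAt_nonneg hρ (fun t => norm_nonneg _)
  have hdist : ∀ s t, 0 ≤ s → s ≤ t → ‖x t - x s‖ ≤ ρ t - ρ s := by
    intro s t hs hst
    refine image_norm_le_of_norm_deriv_right_le_deriv_boundary (a := s) (b := t)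
      (f := fun τ => x τ - x s) (f' := fun τ => -gradient L (x τ))
      (B := fun τ => ρ τ - ρ s) (B' := n) ?_ ?_ (by simp) ?_ ?_ (right_mem_Icc.2 hst)
    · exact (hxc.mono fun τ hτ => hs.trans hτ.1).sub continuousOn_const
    · exact fun τ hτ => (hx' τ (hs.trans hτ.1)).sub_const _
    · exact fun τ => (hρ τ).sub_const _
    · intro τ hτ
      rw [norm_neg, hnx τ (hs.trans hτ.1)]
  have hxρ : ∀ t, 0 ≤ t → ‖x t‖ ≤ ρ t := by
    intro t ht
    have h1 := hdist 0 t le_rfl ht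
    have h2 := norm_sub_norm_le (x t) (x 0)
    linarith
  have hkey : ∀ t, 0 ≤ t → (∫ v in (0 : ℝ)..ρ t, c v) + 2 * √(L (x t))
      ≤ (∫ v in (0 : ℝ)..‖x 0‖, c v) + 2 * √(L (x 0)) := by
    intro t ht
    rw [← hρ0]
    refine integral_add_le_of_hasDerivWithinAt (E := fun τ => 2 * √(L (x τ)))
      (e := fun τ => -(‖gradient L (x τ)‖ ^ 2 / √(L (x τ)))) hc hρ hρm
      (hLxc.sqrt.const_mul 2) ?_ ?_ ht
    · intro s hs
      rcases (hL_nonneg (x s)).eq_or_lt with h0 | hpos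
      · have hz : ∀ τ ∈ Ici s, 2 * √(L (x τ)) = 0 := by
          intro τ hτ
          have := hLanti hs (show τ ∈ Ici (0 : ℝ) from hs.trans hτ) hτ
          rw [Real.sqrt_eq_zero_of_nonpos (by simpa [← h0] using this), mul_zero]
        rw [← h0]
        simpa using (hasDerivWithinAt_const s (Ici s) (0 : ℝ)).congr hz (hz s self_mem_Ici)
      · have h := (((hLx s hs).mono (Ici_subset_Ici.2 hs)).sqrt hpos.ne').const_mul 2
        refine h.congr_deriv ?_
        have := (Real.sqrt_pos.2 hpos).ne'
        field_simp
    · intro s hs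
      rw [hnx s hs, neg_le_neg_iff]
      rcases (hL_nonneg (x s)).eq_or_lt with h0 | hpos
      · simp [gradient_eq_zero_of_forall_ge (z := x s) (fun w => h0 ▸ hL_nonneg w)]
      · rw [le_div_iff₀ (Real.sqrt_pos.2 hpos)]
        have h1 : c (ρ s) * √(L (x s)) ≤ ‖gradient L (x s)‖ :=
          (mul_le_mul_of_nonneg_right (hc (hxρ s hs)) (Real.sqrt_nonneg _)).trans (hLoj _)
        nlinarith [mul_le_mul_of_nonneg_right h1 (norm_nonneg (gradient L (x s)))]
  set k : ℝ := ((∫ v in (0 : ℝ)..R, c v) -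
    ((∫ v in (0 : ℝ)..‖x 0‖, c v) + 2 * √(L (x 0)))) / R with hk
  have hk0 : 0 < k := div_pos (by linarith) hR
  have hρR : ∀ t, 0 ≤ t → ρ t ≤ R ∧ k ≤ c (ρ t) := by
    intro t ht
    have h1 := hkey t ht
    have h2 := Real.sqrt_nonneg (L (x t))
    have h3 := intervalIntegral.integral_add_adjacent_intervals (hint 0 (ρ t)) (hint (ρ t) R)
    have hle : ρ t ≤ R := by
      by_contra! h
      have h4 := intervalIntegral.integral_nonneg (μ := MeasureTheory.volume) h.le
        (fun v _ => hc_nonneg v)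
      rw [intervalIntegral.integral_symm] at h4
      linarith
    refine ⟨hle, ?_⟩
    have h5 := integral_le_mul_sub_of_antitone hc hle
    have h6 : 0 ≤ ρ t := (norm_nonneg _).trans (hxρ t ht)
    rw [hk, div_le_iff₀ hR]
    nlinarith [mul_nonneg (hc_nonneg (ρ t)) h6]
  have hbdd : ∀ t, ρ t ≤ R := fun t =>
    (hρm (le_max_left t 0)).trans (hρR _ (le_max_right t 0)).1
  obtain ⟨l, hl⟩ : ∃ l, Tendsto ρ atTop (𝓝 l) :=
    ⟨_, tendsto_atTop_ciSup hρm ⟨R, by rintro _ ⟨t, rfl⟩; exact hbdd t⟩⟩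
  have hρl : ∀ t, ρ t ≤ l := fun t => hρm.ge_of_tendsto hl t
  obtain ⟨xinf, hxinf⟩ : ∃ xinf, Tendsto x atTop (𝓝 xinf) := by
    refine cauchySeq_tendsto_of_complete (Metric.cauchySeq_iff'.2 fun ε hε => ?_)
    obtain ⟨N, hN, hN0⟩ := ((hl.eventually_const_lt (show l - ε < l by linarith)).and
      (eventually_ge_atTop 0)).exists
    refine ⟨N, fun t ht => ?_⟩
    rw [dist_eq_norm]
    linarith [hdist N t hN0 ht, hρl t]
  refine ⟨xinf, ?_, ?_, hxinf⟩
  · refine le_of_tendsto hxinf.norm ?_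
    filter_upwards [eventually_ge_atTop 0] with t ht
    exact (hxρ t ht).trans (hbdd t)
  · by_contra hne
    have hpos : 0 < L xinf := lt_of_le_of_ne (hL_nonneg _) (Ne.symm hne)
    have hLlim : Tendsto (fun t => L (x t)) atTop (𝓝 (L xinf)) :=
      (hL.continuous.tendsto xinf).comp hxinf
    have hLge : ∀ t, 0 ≤ t → L xinf ≤ L (x t) := by
      intro t ht
      refine le_of_tendsto hLlim ?_
      filter_upwards [eventually_ge_atTop t] with s hs
      exact hLanti ht (ht.trans hs) hs
    have hnge : ∀ t, 0 ≤ t → k * √(L xinf) ≤ n t := by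
      intro t ht
      rw [hnx t ht]
      refine le_trans ?_ (hLoj (x t))
      exact mul_le_mul ((hρR t ht).2.trans (hc (hxρ t ht))) (Real.sqrt_le_sqrt (hLge t ht))
        (Real.sqrt_nonneg _) (hc_nonneg _)
    set m : ℝ := k * √(L xinf) with hm
    have hm0 : 0 < m := mul_pos hk0 (Real.sqrt_pos.2 hpos)
    have hgrow : ∀ t, 0 ≤ t → m * t ≤ ρ t := by
      intro t ht
      have h := intervalIntegral.integral_mono_on (μ := MeasureTheory.volume) (f := fun _ => m) ht
        (by simp) (hnc.intervalIntegrable 0 t) (fun τ hτ => hnge τ hτ.1)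
      simp only [intervalIntegral.integral_const, smul_eq_mul, sub_zero] at h
      have h' := norm_nonneg (x 0)
      simp only [hρdef]
      linarith
    have h := (hgrow ((R + 1) / m) (by positivity)).trans (hbdd _)
    rw [mul_div_cancel₀ _ hm0.ne'] at h
    linarith


/-- Under the Łojasiewicz-type assumption with nonincreasing constant
`c(·)` and `C(z) = ∫₀^z c(v) dv`, if a gradient-flow trajectory `x` of `L` satisfies
`C(R) > C(‖x(0)‖) + 2√(L(x(0)))` for some `R > 0`, then `x(t)` converges as `t → ∞` to
some `x_∞` with `‖x_∞‖ ≤ R` and `L(x_∞) = 0`. -/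
theorem stmt_3 {H : Type*} [NormedAddCommGroup H] [InnerProductSpace ℝ H] [CompleteSpace H]
    (L : H → ℝ) (hL_nonneg : ∀ z, 0 ≤ L z) (hL : ContDiff ℝ 2 L)
    (c : ℝ → ℝ) (hc_nonneg : ∀ r, 0 ≤ r → 0 ≤ c r) (hc_anti : AntitoneOn c (Set.Ici 0))
    (hLoj : ∀ r, 0 ≤ r → ∀ z : H, ‖z‖ ≤ r → c r * Real.sqrt (L z) ≤ ‖gradient L z‖)
    (x : ℝ → H)
    (hx : ∀ t ∈ Set.Ici (0 : ℝ), HasDerivWithinAt x (-gradient L (x t)) (Set.Ici 0) t)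
    (R : ℝ) (hR : 0 < R)
    (hRC : (∫ v in (0 : ℝ)..‖x 0‖, c v) + 2 * Real.sqrt (L (x 0)) < ∫ v in (0 : ℝ)..R, c v) :
    ∃ xinf : H, ‖xinf‖ ≤ R ∧ L xinf = 0 ∧
      Filter.Tendsto x Filter.atTop (nhds xinf) := by
  have hcongr : ∀ b, 0 ≤ b → ∫ v in (0 : ℝ)..b, c (max v 0) = ∫ v in (0 : ℝ)..b, c v := by
    intro b hb
    refine intervalIntegral.integral_congr fun v hv => ?_
    rw [uIcc_of_le hb] at hv
    simp [hv.1]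
  refine exists_tendsto_gradientFlow_of_antitone L hL_nonneg hL (fun r => c (max r 0))
    (fun r => hc_nonneg _ (le_max_right _ _))
    (fun a b hab => hc_anti (mem_Ici.2 (le_max_right _ _)) (mem_Ici.2 (le_max_right _ _))
      (max_le_max_right 0 hab))
    (fun z => ?_) x hx R hR ?_
  · simpa using hLoj ‖z‖ (norm_nonneg z) z le_rfl
  · rwa [hcongr _ (norm_nonneg _), hcongr _ hR.le]
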